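/- arXiv:1806.03475 — 2 statements merged into one kernel-verified Lean document; each statement's English description precedes it below -/
import Mathlib

section
/- Let A be an n×n real matrix with p distinct (complex) eigenvalues, of which λ_1,…,λ_{p_r} are real and (λ_{p_r+j}, λ_{p_r+j+p_c/2}) are complex-conjugate pairs for j = 1,…,p_c/2 (so p = p_r + p_c), with geometric multiplicities k_i and maximum geometric multiplicity k_max. If l ≥ k_max and l ≥ min{ Σ_{i=1}^{p_r+p_c/2} k_i , 1 + Σ_{i=1}^{p_r+p_c/2} k_i(k_i − 1)/2 }, then the l-MSCP optimum of A equals the MACP optimum of A. -/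
open Matrix

noncomputable section

/-- The controllability matrix `[B, AB, A²B, …, A^{n-1}B]`, as an `n × (n·l)` matrix. -/
def ctrbMat {R : Type} [CommRing R] {n l : ℕ} (A : Matrix (Fin n) (Fin n) R)
    (B : Matrix (Fin n) (Fin l) R) : Matrix (Fin n) (Fin n × Fin l) R :=
  Matrix.of fun i jk => (A ^ (jk.1 : ℕ) * B) i jk.2

/-- `(A, B)` is controllable iff the controllability matrix has rank `n`. -/
def Controllable {R : Type} [CommRing R] {n l : ℕ} (A : Matrix (Fin n) (Fin n) R)
    (B : Matrix (Fin n) (Fin l) R) : Prop :=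
  (ctrbMat A B).rank = n

/-- The columns of a matrix, as vectors. -/
def matCols {R : Type} [CommRing R] {n k : ℕ} (X : Matrix (Fin n) (Fin k) R) :
    Fin k → (Fin n → R) := fun j i => X i j

/-- `X` is an `n × k` matrix whose columns are a basis of the λ-eigenspace of `Aᵀ`
(equivalently, its columns are `k` linearly independent left eigenvectors of `A`
for `μ`, spanning the whole left eigenspace; in particular `k` is the geometric
multiplicity of `μ`). -/
def IsLeftEigenbasis {n k : ℕ} (A : Matrix (Fin n) (Fin n) ℂ) (μ : ℂ)
    (X : Matrix (Fin n) (Fin k) ℂ) : Prop :=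
  LinearIndependent ℂ (matCols X) ∧
  (∀ j, A.transpose.mulVec (matCols X j) = μ • matCols X j) ∧
  (∀ v : Fin n → ℂ, A.transpose.mulVec v = μ • v →
      v ∈ Submodule.span ℂ (Set.range (matCols X)))

/-- The submatrix of `M` consisting of the columns indexed by `S`. -/
def colSub {R : Type} [CommRing R] {m n : ℕ} (M : Matrix (Fin m) (Fin n) R)
    (S : Finset (Fin n)) : Matrix (Fin m) {x // x ∈ S} R :=
  M.submatrix id (fun j => (j : Fin n))

/-- `H = {J ⊆ {1,…,n} : |J| = k and the k×k submatrix of Xᵀ formed by the columns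
indexed by J is invertible}` (invertibility of the square submatrix is expressed
as full rank `k`). -/
def Hset {n k : ℕ} (X : Matrix (Fin n) (Fin k) ℂ) : Set (Finset (Fin n)) :=
  {J | J.card = k ∧ (colSub X.transpose J).rank = k}

/-- The diagonal 0/1 matrix `I_S` selecting the states in `S`. -/
def diagSel {n : ℕ} (S : Finset (Fin n)) : Matrix (Fin n) (Fin n) ℝ :=
  Matrix.diagonal (fun j => if j ∈ S then (1 : ℝ) else 0)

/-- `‖B‖₀`, the number of nonzero entries of `B`. -/
def sparsity {n l : ℕ} (B : Matrix (Fin n) (Fin l) ℝ) : ℕ :=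
  (Finset.univ.filter fun jc : Fin n × Fin l => B jc.1 jc.2 ≠ 0).card

/-- The MACP optimum: the minimal cardinality of a set `S` of actuated states
such that `(A, I_S)` is controllable. -/
def MACPopt {n : ℕ} (A : Matrix (Fin n) (Fin n) ℝ) : ℕ :=
  sInf {m | ∃ S : Finset (Fin n), Controllable A (diagSel S) ∧ S.card = m}

/-- The `l`-MSCP optimum: the minimal number of nonzero entries of an `n × l`
real matrix `B` such that `(A, B)` is controllable. -/
def MSCPopt {n : ℕ} (A : Matrix (Fin n) (Fin n) ℝ) (l : ℕ) : ℕ :=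
  sInf {m | ∃ B : Matrix (Fin n) (Fin l) ℝ, Controllable A B ∧ sparsity B = m}

/-- Controllability as triviality of the left kernel of the controllability matrix. -/
lemma controllable_iff_forall_vecMul {K : Type} [Field K] {n l : ℕ}
    (A : Matrix (Fin n) (Fin n) K) (B : Matrix (Fin n) (Fin l) K) :
    Controllable A B ↔
      ∀ v : Fin n → K, (∀ j < n, v ᵥ* (A ^ j * B) = 0) → v = 0 := by
  have hrank : Controllable A B ↔ LinearIndependent K (ctrbMat A B).row := by
    rw [linearIndependent_iff_card_eq_finrank_span, Set.finrank, ← rank_eq_finrank_span_row,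
      Fintype.card_fin, Controllable, eq_comm]
  have hvec : ∀ v : Fin n → K,
      v ᵥ* ctrbMat A B = 0 ↔ ∀ j < n, v ᵥ* (A ^ j * B) = 0 := by
    intro v
    constructor
    · intro h j hj
      funext c
      exact congrFun h (⟨j, hj⟩, c)
    · intro h
      funext ⟨j, c⟩
      exact congrFun (h j j.2) c
  rw [hrank, ← vecMul_injective_iff, ← coe_vecMulLinear, ← LinearMap.ker_eq_bot,
    LinearMap.ker_eq_bot']
  simp only [vecMulLinear_apply, hvec]

/-- By Cayley–Hamilton, a row vector that annihilates `A ^ j * B` for `j < n` annihilates it for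
all `j`. -/
lemma vecMul_pow_mul_eq_zero {K : Type} [Field K] {n l : ℕ}
    {A : Matrix (Fin n) (Fin n) K} {B : Matrix (Fin n) (Fin l) K} {v : Fin n → K}
    (h : ∀ j < n, v ᵥ* (A ^ j * B) = 0) (j : ℕ) : v ᵥ* (A ^ j * B) = 0 := by
  rcases Nat.eq_zero_or_pos n with rfl | hn
  · rw [Subsingleton.elim v 0, zero_vecMul]
  have hdeg : (Polynomial.X ^ j %ₘ A.charpoly).natDegree < n := by
    have := Polynomial.natDegree_modByMonic_lt (Polynomial.X ^ j) A.charpoly_monic (by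
      intro h1
      have := A.charpoly_natDegree_eq_dim
      rw [h1, Polynomial.natDegree_one, Fintype.card_fin] at this
      omega)
    rwa [A.charpoly_natDegree_eq_dim, Fintype.card_fin] at this
  rw [pow_eq_aeval_mod_charpoly, Polynomial.aeval_eq_sum_range' hdeg, Matrix.sum_mul,
    vecMul_sum]
  refine Finset.sum_eq_zero fun i hi => ?_
  rw [Matrix.smul_mul, vecMul_smul, h i (Finset.mem_range.mp hi), smul_zero]

/-- Complexification commutes with forming `A ^ j * B`. -/
lemma map_ofReal_pow_mul {n l : ℕ} (A : Matrix (Fin n) (Fin n) ℝ)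
    (B : Matrix (Fin n) (Fin l) ℝ) (j : ℕ) :
    (A ^ j * B).map Complex.ofReal = (A.map Complex.ofReal) ^ j * B.map Complex.ofReal := by
  have := Matrix.map_mul (L := A ^ j) (M := B) (f := Complex.ofRealHom)
  rwa [Matrix.map_pow] at this

/-- A real controllable pair has no complex left eigenvector annihilating `B`. -/
lemma Controllable.eq_zero_of_vecMul_eq_smul {n l : ℕ} {A : Matrix (Fin n) (Fin n) ℝ}
    {B : Matrix (Fin n) (Fin l) ℝ} (h : Controllable A B) {z : ℂ} {v : Fin n → ℂ}
    (hv : v ᵥ* A.map Complex.ofReal = z • v) (hvB : v ᵥ* B.map Complex.ofReal = 0) :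
    v = 0 := by
  rw [controllable_iff_forall_vecMul] at h
  have hpow : ∀ j : ℕ, v ᵥ* (A ^ j * B).map Complex.ofReal = 0 := by
    intro j
    have hA : v ᵥ* (A.map Complex.ofReal) ^ j = z ^ j • v := by
      induction j with
      | zero => simp
      | succ j ih => rw [pow_succ, ← vecMul_vecMul, ih, smul_vecMul, hv, smul_smul, pow_succ]
    rw [map_ofReal_pow_mul, ← vecMul_vecMul, hA, smul_vecMul, hvB, smul_zero]
  have hre : (fun i => (v i).re) = 0 := h _ fun j _ => by
    funext c
    have := congrArg Complex.re (congrFun (hpow j) c)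
    simpa [vecMul, dotProduct] using this
  have him : (fun i => (v i).im) = 0 := h _ fun j _ => by
    funext c
    have := congrArg Complex.im (congrFun (hpow j) c)
    simpa [vecMul, dotProduct] using this
  funext i
  exact Complex.ext (congrFun hre i) (congrFun him i)

/-- The Popov–Belevitch–Hautus test: a real pair without complex left eigenvectors annihilating
`B` is controllable. -/
lemma controllable_of_forall_vecMul_eq_smul {n l : ℕ} {A : Matrix (Fin n) (Fin n) ℝ}
    {B : Matrix (Fin n) (Fin l) ℝ}
    (h : ∀ (z : ℂ) (v : Fin n → ℂ), v ᵥ* A.map Complex.ofReal = z • v →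
      v ᵥ* B.map Complex.ofReal = 0 → v = 0) : Controllable A B := by
  rw [controllable_iff_forall_vecMul]
  intro v hv
  by_contra hne
  set A' := A.map Complex.ofReal
  set B' := B.map Complex.ofReal
  let W : Submodule ℂ (Fin n → ℂ) := ⨅ j : ℕ, LinearMap.ker (A' ^ j * B').vecMulLinear
  have hW : ∀ u, u ∈ W ↔ ∀ j : ℕ, u ᵥ* (A' ^ j * B') = 0 := by
    intro u
    simp [W, Submodule.mem_iInf]
  have hinv : ∀ u ∈ W, A'.vecMulLinear u ∈ W := by
    intro u hu
    rw [hW] at hu ⊢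
    intro j
    rw [vecMulLinear_apply, vecMul_vecMul, ← Matrix.mul_assoc, ← pow_succ']
    exact hu (j + 1)
  have hmem : (fun i => (v i : ℂ)) ∈ W := by
    rw [hW]
    intro j
    rw [← map_ofReal_pow_mul]
    have := vecMul_pow_mul_eq_zero hv j
    funext c
    have := congrArg Complex.ofReal (congrFun this c)
    simpa [vecMul, dotProduct] using this
  have : Nontrivial W := by
    refine ⟨⟨⟨_, hmem⟩, 0, fun h0 => hne ?_⟩⟩
    funext i
    exact Complex.ofReal_eq_zero.mp (congrFun (congrArg Subtype.val h0) i)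
  obtain ⟨z, hz⟩ := Module.End.exists_eigenvalue (A'.vecMulLinear.restrict hinv)
  obtain ⟨u, hu⟩ := hz.exists_hasEigenvector
  refine hu.2 (Subtype.ext (h z u ?_ ?_))
  · exact congrArg Subtype.val hu.apply_eq_smul
  · simpa using (hW u).1 u.2 0

/-- A graph with edge set `E` admits a proper colouring with `E.card + 1` colours. -/
lemma exists_coloring_of_edges {V : Type*} [DecidableEq V] (E : Finset (Finset V))
    (hE : ∀ e ∈ E, e.card = 2) :
    ∃ c : V → ℕ, (∀ v, c v ≤ E.card) ∧ ∀ e ∈ E, Set.InjOn c e := by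
  induction E using Finset.induction_on with
  | empty => exact ⟨fun _ => 0, by simp⟩
  | insert e E he ih =>
    obtain ⟨c, hc, hinj⟩ := ih fun e' he' => hE e' (Finset.mem_insert_of_mem he')
    obtain ⟨a, b, hab, rfl⟩ := Finset.card_eq_two.mp (hE e (Finset.mem_insert_self _ _))
    rw [Finset.card_insert_of_notMem he]
    refine ⟨Function.update c a (E.card + 1), fun v => ?_, fun e' he' => ?_⟩
    · have := hc v
      by_cases hva : v = a
      · simp [hva]
      · simp [hva]; omega
    · intro x hx y hy hxy
      have hcx := hc x
      have hcy := hc y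
      by_cases hxa : x = a <;> by_cases hya : y = a
      · rw [hxa, hya]
      · rw [hxa, Function.update_self, Function.update_of_ne hya] at hxy
        omega
      · rw [hya, Function.update_self, Function.update_of_ne hxa] at hxy
        omega
      · rw [Function.update_of_ne hxa, Function.update_of_ne hya] at hxy
        rcases Finset.mem_insert.mp he' with rfl | he'
        · simp only [Finset.coe_insert, Finset.coe_singleton, Set.mem_insert_iff,
            Set.mem_singleton_iff] at hx hy
          rw [hx.resolve_left hxa, hy.resolve_left hya]
        · exact hinj e' he' hx hy hxy

/-- Finitely many sets `J i` with `(J i).card ≤ k i` can be coloured with `l` colours so that each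
`J i` is rainbow, provided `l` is at least `∑ k i` or `1 + ∑ k i (k i - 1) / 2`. -/
lemma exists_rainbow_coloring {ι V : Type*} [Fintype ι] [DecidableEq V] (J : ι → Finset V)
    (k : ι → ℕ) (hJ : ∀ i, (J i).card ≤ k i) {l : ℕ}
    (hl : min (∑ i, k i) (1 + ∑ i, k i * (k i - 1) / 2) ≤ l) :
    ∃ c : V → ℕ, (∀ v ∈ Finset.univ.biUnion J, c v < l) ∧ ∀ i, Set.InjOn c (J i) := by
  rcases min_le_iff.mp hl with hl | hl
  · set U := Finset.univ.biUnion J with hU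
    have hcard : U.card ≤ l :=
      (Finset.card_biUnion_le.trans (Finset.sum_le_sum fun i _ => hJ i)).trans hl
    refine ⟨fun v => if hv : v ∈ U then U.equivFin ⟨v, hv⟩ else 0, fun v hv => ?_, fun i => ?_⟩
    · simp only [hv, dif_pos]
      exact (Fin.is_lt _).trans_le hcard
    · intro x hx y hy hxy
      have hxU : x ∈ U := Finset.mem_biUnion.mpr ⟨i, Finset.mem_univ _, hx⟩
      have hyU : y ∈ U := Finset.mem_biUnion.mpr ⟨i, Finset.mem_univ _, hy⟩
      simp only [hxU, hyU, dif_pos] at hxy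
      exact congrArg Subtype.val (U.equivFin.injective (Fin.ext hxy))
  · obtain ⟨c, hc, hinj⟩ := exists_coloring_of_edges
      (Finset.univ.biUnion fun i => (J i).powersetCard 2) (by
        simp only [Finset.mem_biUnion, Finset.mem_powersetCard]
        rintro e ⟨i, -, -, he⟩
        exact he)
    have hcard : (Finset.univ.biUnion fun i => (J i).powersetCard 2).card ≤
        ∑ i, k i * (k i - 1) / 2 := by
      refine Finset.card_biUnion_le.trans (Finset.sum_le_sum fun i _ => ?_)
      rw [Finset.card_powersetCard, ← Nat.choose_two_right]
      exact Nat.choose_le_choose 2 (hJ i)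
    refine ⟨c, fun v _ => ?_, fun i x hx y hy hxy => ?_⟩
    · have := hc v
      omega
    · by_contra hne
      refine hne (hinj {x, y} ?_ (by simp) (by simp) hxy)
      simp only [Finset.mem_biUnion, Finset.mem_univ, true_and, Finset.mem_powersetCard]
      refine ⟨i, ?_, Finset.card_pair hne⟩
      intro a ha
      rcases Finset.mem_insert.mp ha with rfl | ha
      · exact hx
      · rw [Finset.mem_singleton.mp ha]
        exact hy

/-- If the coordinates in `S` separate the points of a subspace `E`, then so do at most `dim E` of
them. -/
lemma exists_subset_card_le_finrank {K ι : Type*} [Field K] [Finite ι]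
    (E : Submodule K (ι → K)) (S : Finset ι)
    (hS : ∀ v ∈ E, (∀ j ∈ S, v j = 0) → v = 0) :
    ∃ J ⊆ S, J.card ≤ Module.finrank K E ∧ ∀ v ∈ E, (∀ j ∈ J, v j = 0) → v = 0 := by
  classical
  let f : ι → Module.Dual K E := fun j => (LinearMap.proj j).comp E.subtype
  obtain ⟨b, hbS, -, hspan, hli⟩ := exists_linearIndepOn_extension
    (linearIndepOn_empty K f) (Set.empty_subset (S : Set ι))
  lift b to Finset ι using S.finite_toSet.subset hbS
  refine ⟨b, by exact_mod_cast hbS, ?_, fun v hv h0 => hS v hv fun j hj => ?_⟩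
  · have := LinearIndependent.fintype_card_le_finrank hli
    rw [Subspace.dual_finrank_eq] at this
    simpa using this
  · have hle : Submodule.span K (f '' b) ≤
        LinearMap.ker (Module.Dual.eval K E ⟨v, hv⟩) := by
      rw [Submodule.span_le]
      rintro _ ⟨i, hi, rfl⟩
      exact h0 i hi
    exact hle (hspan ⟨j, hj, rfl⟩)

/-- Suppose the coordinates in `J` separate the points of `E`, and each `j ∈ J` has a class `c`
of the relation `r` in which it is the only element of `J`. Then for weights `w` outside the zero
locus of a nonzero polynomial, the weighted sums over the classes separate the points of `E`. -/
lemma exists_mvPolynomial_separating {K ι κ : Type*} [Field K] [Fintype ι] [Fintype κ]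
    (E : Submodule K (ι → K)) (J : Finset ι) (r : ι → κ → Prop) [∀ j c, Decidable (r j c)]
    (hr : ∀ j ∈ J, ∃ c, r j c ∧ ∀ j' ∈ J, r j' c → j' = j)
    (hJ : ∀ v ∈ E, (∀ j ∈ J, v j = 0) → v = 0) :
    ∃ P : MvPolynomial ι K, P ≠ 0 ∧ ∀ w : ι → K, MvPolynomial.eval w P ≠ 0 →
      ∀ v ∈ E, (∀ c, ∑ j, (if r j c then w j * v j else 0) = 0) → v = 0 := by
  classical
  let b := Module.finBasis K E
  let T : (ι → K) → Matrix κ (Fin (Module.finrank K E)) K := fun w =>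
    of fun c a => ∑ j, if r j c then w j * (b a : ι → K) j else 0
  have hT : ∀ w x c, (T w *ᵥ x) c =
      ∑ j, if r j c then w j * (b.equivFun.symm x : ι → K) j else 0 := by
    intro w x c
    simp only [mulVec, dotProduct, T, of_apply, Finset.sum_mul, Module.Basis.equivFun_symm_apply,
      Submodule.coe_sum, Submodule.coe_smul, Finset.sum_apply, Pi.smul_apply, smul_eq_mul]
    rw [Finset.sum_comm]
    refine Finset.sum_congr rfl fun j _ => ?_
    split_ifs
    · rw [Finset.mul_sum]
      exact Finset.sum_congr rfl fun a _ => by ring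
    · simp
  let w₀ : ι → K := fun j => if j ∈ J then 1 else 0
  have hker : LinearMap.ker (T w₀).mulVecLin = ⊥ := by
    rw [LinearMap.ker_eq_bot']
    intro x hx
    have hzero : b.equivFun.symm x = 0 := by
      refine Subtype.ext (hJ _ (Subtype.mem _) fun j hj => ?_)
      obtain ⟨c, hc, huniq⟩ := hr j hj
      have := congrFun hx c
      rw [mulVecLin_apply, hT, Finset.sum_eq_single j] at this
      · simpa [hc, w₀, hj] using this
      · intro j' _ hne
        by_cases hj' : j' ∈ J
        · rw [if_neg fun h => hne (huniq j' hj' h)]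
        · simp [w₀, hj']
      · simp
    exact b.equivFun.symm.map_eq_zero_iff.mp hzero
  obtain ⟨g, hg⟩ := LinearMap.exists_leftInverse_of_injective _ hker
  let G := LinearMap.toMatrix' g
  have hG : G * T w₀ = 1 := by
    have := congrArg LinearMap.toMatrix' hg
    rw [LinearMap.toMatrix'_comp, LinearMap.toMatrix'_id] at this
    rwa [← Matrix.toLin'_apply', LinearMap.toMatrix'_toLin'] at this
  let TX : Matrix κ (Fin (Module.finrank K E)) (MvPolynomial ι K) :=
    of fun c a => ∑ j, if r j c then MvPolynomial.X j * MvPolynomial.C ((b a : ι → K) j) else 0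
  let GX : Matrix (Fin (Module.finrank K E)) κ (MvPolynomial ι K) := G.map MvPolynomial.C
  let N : Matrix (Fin (Module.finrank K E)) (Fin (Module.finrank K E)) (MvPolynomial ι K) :=
    GX * TX
  have hP : ∀ w, MvPolynomial.eval w N.det = (G * T w).det := by
    intro w
    rw [RingHom.map_det]
    congr 1
    ext a a'
    simp [N, GX, TX, T, mul_apply, apply_ite]
  refine ⟨N.det, fun h0 => ?_, fun w hw v hv hsum => ?_⟩
  · have := hP w₀
    rw [h0, hG, det_one, map_zero] at this
    exact zero_ne_one this
  · rw [hP] at hw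
    have hx : T w *ᵥ b.equivFun ⟨v, hv⟩ = 0 := by
      funext c
      rw [hT]
      simpa using hsum c
    have h0 : b.equivFun ⟨v, hv⟩ = 0 := by
      refine eq_zero_of_mulVec_eq_zero hw ?_
      rw [← mulVec_mulVec, hx, mulVec_zero]
    simpa using h0

/-- Finitely many nonzero complex polynomials have a common real point of nonvanishing. -/
lemma exists_real_eval_ne_zero {ι σ : Type*} [Fintype ι] (P : ι → MvPolynomial σ ℂ)
    (hP : ∀ i, P i ≠ 0) :
    ∃ w : σ → ℝ, ∀ i, MvPolynomial.eval (fun j => (w j : ℂ)) (P i) ≠ 0 := by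
  by_contra! h
  have hprod : ∏ i, P i = 0 := by
    refine MvPolynomial.funext_set (fun _ => Set.range Complex.ofReal)
      (fun _ => Set.infinite_range_of_injective Complex.ofReal_injective) fun x hx => ?_
    choose w hw using fun j => hx j (Set.mem_univ j)
    obtain rfl : (fun j => (w j : ℂ)) = x := funext hw
    obtain ⟨i, hi⟩ := h w
    rw [map_prod, map_zero, Finset.prod_eq_zero (Finset.mem_univ i) hi]
  obtain ⟨i, -, hi⟩ := Finset.prod_eq_zero_iff.mp hprod
  exact hP i hi

/-- The geometric multiplicity is the dimension of the left eigenspace. -/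
lemma finrank_ker_vecMulLinear {K : Type*} [Field K] {n : ℕ} (M : Matrix (Fin n) (Fin n) K) :
    Module.finrank K (LinearMap.ker M.vecMulLinear) = n - M.rank := by
  have h := M.vecMulLinear.finrank_range_add_finrank_ker
  have hr : M.rank = Module.finrank K (LinearMap.range M.vecMulLinear) := by
    rw [← rank_transpose, rank, mulVecLin_transpose]
  rw [Module.finrank_fin_fun] at h
  omega

/-- The rows of `B` carrying a nonzero entry form an actuation set for which `A` is
controllable. -/
lemma exists_controllable_diagSel {n l : ℕ} {A : Matrix (Fin n) (Fin n) ℝ}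
    {B : Matrix (Fin n) (Fin l) ℝ} (h : Controllable A B) :
    ∃ S : Finset (Fin n), Controllable A (diagSel S) ∧ S.card ≤ sparsity B := by
  classical
  let N := Finset.univ.filter fun jc : Fin n × Fin l => B jc.1 jc.2 ≠ 0
  refine ⟨N.image Prod.fst, controllable_of_forall_vecMul_eq_smul fun z v hv hS => ?_,
    Finset.card_image_le⟩
  refine h.eq_zero_of_vecMul_eq_smul hv ?_
  have hv0 : ∀ j ∈ N.image Prod.fst, v j = 0 := by
    intro j hj
    have := congrFun hS j
    rw [diagSel, diagonal_map Complex.ofReal_zero, vecMul_diagonal] at this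
    simpa [hj] using this
  funext c
  rw [vecMul, dotProduct, Pi.zero_apply]
  refine Finset.sum_eq_zero fun j _ => ?_
  by_cases hB : B j c = 0
  · simp [hB]
  · rw [hv0 j (Finset.mem_image.mpr ⟨(j, c), by simp [N, hB], rfl⟩), zero_mul]

/-- All states actuated gives a controllable pair. -/
lemma controllable_diagSel_univ {n : ℕ} (A : Matrix (Fin n) (Fin n) ℝ) :
    Controllable A (diagSel Finset.univ) := by
  refine controllable_of_forall_vecMul_eq_smul fun z v _ hv => ?_
  funext j
  have := congrFun hv j
  rw [diagSel, diagonal_map Complex.ofReal_zero, vecMul_diagonal] at this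
  simpa using this

/-- If every complex eigenvalue of `A` is some `μ i` or the conjugate of one, and a real `B`
annihilates no left eigenvector for the `μ i`, then `(A, B)` is controllable. -/
lemma controllable_of_spectrum_subset {n l : ℕ} {ι : Type*} {A : Matrix (Fin n) (Fin n) ℝ}
    {B : Matrix (Fin n) (Fin l) ℝ} {μ : ι → ℂ}
    (hspec : spectrum ℂ (A.map Complex.ofReal) ⊆
      Set.range μ ∪ (starRingEnd ℂ) '' Set.range μ)
    (h : ∀ (i : ι) (v : Fin n → ℂ), v ᵥ* A.map Complex.ofReal = μ i • v →
      v ᵥ* B.map Complex.ofReal = 0 → v = 0) : Controllable A B := by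
  have hconj : ∀ {m : ℕ} (M : Matrix (Fin n) (Fin m) ℝ) (v : Fin n → ℂ),
      star v ᵥ* M.map Complex.ofReal = star (v ᵥ* M.map Complex.ofReal) := by
    intro m M v
    funext c
    simp [vecMul, dotProduct]
  refine controllable_of_forall_vecMul_eq_smul fun z v hv hvB => ?_
  by_contra hne
  have hz : z ∈ spectrum ℂ (A.map Complex.ofReal) := by
    rw [spectrum.mem_iff]
    intro hu
    refine hne (vecMul_injective_of_isUnit hu ?_)
    simp only [zero_vecMul]
    rw [vecMul_sub, hv, Algebra.algebraMap_eq_smul_one, vecMul_smul, vecMul_one, sub_self]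
  rcases hspec hz with ⟨i, rfl⟩ | ⟨_, ⟨i, rfl⟩, rfl⟩
  · exact hne (h i v hv hvB)
  · refine hne (star_eq_zero.mp (h i (star v) ?_ ?_))
    · rw [hconj, hv, star_smul]
      simp
    · rw [hconj, hvB, star_zero]

/-- From an actuation set `S` one obtains a controllable `n × l` matrix with at most `S.card`
nonzero entries, when `l` is large enough. -/
lemma exists_controllable_sparsity_le {n l : ℕ} {ι : Type*} [Fintype ι]
    {A : Matrix (Fin n) (Fin n) ℝ} {μ : ι → ℂ}
    (hspec : spectrum ℂ (A.map Complex.ofReal) ⊆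
      Set.range μ ∪ (starRingEnd ℂ) '' Set.range μ)
    {k : ι → ℕ}
    (hk : ∀ i, k i =
      n - (μ i • (1 : Matrix (Fin n) (Fin n) ℂ) - A.map Complex.ofReal).rank)
    (hl : min (∑ i, k i) (1 + ∑ i, k i * (k i - 1) / 2) ≤ l)
    {S : Finset (Fin n)} (hS : Controllable A (diagSel S)) :
    ∃ B : Matrix (Fin n) (Fin l) ℝ, Controllable A B ∧ sparsity B ≤ S.card := by
  classical
  let E : ι → Submodule ℂ (Fin n → ℂ) := fun i =>
    LinearMap.ker (μ i • (1 : Matrix (Fin n) (Fin n) ℂ) - A.map Complex.ofReal).vecMulLinear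
  have hE : ∀ i v, v ∈ E i ↔ v ᵥ* A.map Complex.ofReal = μ i • v := by
    intro i v
    rw [LinearMap.mem_ker, vecMulLinear_apply, vecMul_sub, vecMul_smul, vecMul_one, sub_eq_zero,
      eq_comm]
  have hES : ∀ i, ∀ v ∈ E i, (∀ j ∈ S, v j = 0) → v = 0 := by
    intro i v hv h0
    refine hS.eq_zero_of_vecMul_eq_smul ((hE i v).mp hv) ?_
    funext j
    rw [diagSel, diagonal_map Complex.ofReal_zero, vecMul_diagonal]
    by_cases hj : j ∈ S
    · simp [h0 j hj]
    · simp [hj]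
  choose J hJS hJcard hJ using fun i => exists_subset_card_le_finrank (E i) S (hES i)
  obtain ⟨col, hcol, hinj⟩ := exists_rainbow_coloring J k
    (fun i => (hJcard i).trans_eq (by rw [finrank_ker_vecMulLinear, hk])) hl
  set U := Finset.univ.biUnion J
  let r : Fin n → Fin l → Prop := fun j c => j ∈ U ∧ col j = c
  have hr : ∀ i, ∀ j ∈ J i, ∃ c, r j c ∧ ∀ j' ∈ J i, r j' c → j' = j := by
    intro i j hj
    have hjU : j ∈ U := Finset.mem_biUnion.mpr ⟨i, Finset.mem_univ _, hj⟩
    exact ⟨⟨col j, hcol j hjU⟩, ⟨hjU, rfl⟩, fun j' hj' h => hinj i hj' hj h.2⟩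
  choose P hP0 hP using fun i => exists_mvPolynomial_separating (E i) (J i) r (hr i) (hJ i)
  obtain ⟨w, hw⟩ := exists_real_eval_ne_zero P hP0
  refine ⟨of fun j c => if r j c then w j else 0,
    controllable_of_spectrum_subset hspec fun i v hv hvB => ?_, ?_⟩
  · refine hP i _ (hw i) v ((hE i v).mpr hv) fun c => ?_
    refine Eq.trans ?_ (congrFun hvB c)
    refine Finset.sum_congr rfl fun j _ => ?_
    by_cases h : r j c <;> simp [h, mul_comm]
  · calc _ ≤ U.card := Finset.card_le_card_of_injOn Prod.fst ?_ ?_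
      _ ≤ S.card := Finset.card_le_card (Finset.biUnion_subset.mpr fun i _ => hJS i)
    · rintro ⟨j, c⟩ h
      by_contra hj
      have hj' : j ∉ U := hj
      simp [r, hj'] at h
    · rintro ⟨j, c⟩ h ⟨j', c'⟩ h' heq
      obtain rfl : j = j' := heq
      have hc : r j c := by
        by_contra hn
        simp [hn] at h
      have hc' : r j c' := by
        by_contra hn
        simp [hn] at h'
      rw [Fin.ext (hc.2.symm.trans hc'.2)]

theorem statement_17 {n pr q : ℕ} (A : Matrix (Fin n) (Fin n) ℝ)
    (μ : Fin (pr + q) → ℂ) (hμ : Function.Injective μ)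
    (hspec : spectrum ℂ (A.map Complex.ofReal) =
      Set.range μ ∪ (starRingEnd ℂ) '' Set.range μ)
    (hreal : ∀ i : Fin (pr + q), (i : ℕ) < pr ↔ (μ i).im = 0)
    (k : Fin (pr + q) → ℕ)
    (hk : ∀ i, k i =
      n - (μ i • (1 : Matrix (Fin n) (Fin n) ℂ) - A.map Complex.ofReal).rank)
    (kmax : ℕ) (hmax : IsGreatest (Set.range k ∪ {0}) kmax)
    (l : ℕ) (hl1 : kmax ≤ l)
    (hl2 : min (∑ i, k i) (1 + ∑ i, k i * (k i - 1) / 2) ≤ l) :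
    MSCPopt A l = MACPopt A := by
  have hne : {m | ∃ S : Finset (Fin n), Controllable A (diagSel S) ∧ S.card = m}.Nonempty :=
    ⟨_, Finset.univ, controllable_diagSel_univ A, rfl⟩
  obtain ⟨S, hS, hScard⟩ := Nat.sInf_mem hne
  obtain ⟨B, hB, hBS⟩ := exists_controllable_sparsity_le hspec.subset hk hl2 hS
  have hne' : {m | ∃ B : Matrix (Fin n) (Fin l) ℝ,
      Controllable A B ∧ sparsity B = m}.Nonempty := ⟨_, B, hB, rfl⟩
  obtain ⟨B', hB', hcard⟩ := Nat.sInf_mem hne'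
  obtain ⟨S', hS', hle⟩ := exists_controllable_diagSel hB'
  have hMSCP : MSCPopt A l ≤ sparsity B := Nat.sInf_le ⟨B, hB, rfl⟩
  have hMACP : MACPopt A ≤ S'.card := Nat.sInf_le ⟨S', hS', rfl⟩
  exact le_antisymm (hMSCP.trans (hBS.trans_eq hScard)) (hMACP.trans (hle.trans_eq hcard))
end
end

section
/- Define g on sparsity patterns P ⊆ {1,2}×{1,2} by g(P) = max{rank(M) : M ∈ ℝ^{2×2}, M_{ij} = 0 whenever (i,j) ∉ P} (the generic rank of P). Let P_1 = {(1,1)}, P_2 = {(1,1),(2,1)}, and e = (1,2). Then P_1 ⊆ P_2, g(P_1 ∪ {e}) − g(P_1) = 0, and g(P_2 ∪ {e}) − g(P_2) = 1; consequently g(P_2 ∪ {e}) − g(P_2) > g(P_1 ∪ {e}) − g(P_1), so the generic-rank function g is not submodular on sparsity patterns ordered by inclusion. -/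
open Matrix

noncomputable section

/-- The generic rank of a 2×2 sparsity pattern. -/
def genRank (P : Set (Fin 2 × Fin 2)) : ℕ :=
  sSup {r | ∃ M : Matrix (Fin 2) (Fin 2) ℝ,
    (∀ i j, (i, j) ∉ P → M i j = 0) ∧ M.rank = r}

/-- The generic rank is the greatest rank of a conforming matrix. -/
theorem genRank_eq_of_isGreatest {P : Set (Fin 2 × Fin 2)} {r : ℕ}
    (h : IsGreatest {r | ∃ M : Matrix (Fin 2) (Fin 2) ℝ,
      (∀ i j, (i, j) ∉ P → M i j = 0) ∧ M.rank = r} r) : genRank P = r :=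
  h.csSup_eq

theorem rank_le_one_of_det_eq_zero {M : Matrix (Fin 2) (Fin 2) ℝ} (h : M.det = 0) :
    M.rank ≤ 1 := by
  by_contra! hM
  have hr : M.rank = 2 := le_antisymm (by simpa using M.rank_le_card_width) hM
  have hspan : LinearMap.range M.mulVecLin = ⊤ :=
    Submodule.eq_top_of_finrank_eq (by simpa [Matrix.rank] using hr)
  have hu : IsUnit M := by
    rw [← Matrix.mulVec_surjective_iff_isUnit]
    exact LinearMap.range_eq_top.mp hspan
  rw [Matrix.isUnit_iff_isUnit_det, h] at hu
  exact not_isUnit_zero hu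

/-- A pattern containing the corner `(0, 0)` all of whose conforming matrices are singular
has generic rank one. -/
theorem genRank_eq_one {P : Set (Fin 2 × Fin 2)} (hP : ((0 : Fin 2), (0 : Fin 2)) ∈ P)
    (hdet : ∀ M : Matrix (Fin 2) (Fin 2) ℝ, (∀ i j, (i, j) ∉ P → M i j = 0) → M.det = 0) :
    genRank P = 1 := by
  have hconf : ∀ i j, (i, j) ∉ P → (!![1, 0; 0, 0] : Matrix (Fin 2) (Fin 2) ℝ) i j = 0 := by
    intro i j hij
    fin_cases i <;> fin_cases j <;> simp_all
  refine genRank_eq_of_isGreatest ⟨⟨!![1, 0; 0, 0], hconf, ?_⟩, ?_⟩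
  · refine le_antisymm (rank_le_one_of_det_eq_zero (hdet _ hconf))
      (Nat.one_le_iff_ne_zero.mpr fun h => ?_)
    rw [Matrix.rank, Submodule.finrank_eq_zero, LinearMap.range_eq_bot] at h
    have h0 := congrFun (LinearMap.congr_fun h ![1, 0]) 0
    simp at h0
  · rintro _ ⟨M, hM, rfl⟩
    exact rank_le_one_of_det_eq_zero (hdet M hM)

/-- A pattern containing the antidiagonal has generic rank two. -/
theorem genRank_eq_two {P : Set (Fin 2 × Fin 2)} (h01 : ((0 : Fin 2), (1 : Fin 2)) ∈ P)
    (h10 : ((1 : Fin 2), (0 : Fin 2)) ∈ P) : genRank P = 2 := by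
  refine genRank_eq_of_isGreatest ⟨⟨!![0, 1; 1, 0], ?_, ?_⟩, ?_⟩
  · intro i j hij
    fin_cases i <;> fin_cases j <;> simp_all
  · have hu : IsUnit (!![0, 1; 1, 0] : Matrix (Fin 2) (Fin 2) ℝ) := by
      simp [Matrix.isUnit_iff_isUnit_det, Matrix.det_fin_two]
    simpa using Matrix.rank_of_isUnit _ hu
  · rintro _ ⟨M, -, rfl⟩
    simpa using M.rank_le_card_width

theorem statement_19 :
    ({((0 : Fin 2), (0 : Fin 2))} : Set (Fin 2 × Fin 2)) ⊆
        ({((0 : Fin 2), (0 : Fin 2)), ((1 : Fin 2), (0 : Fin 2))} : Set (Fin 2 × Fin 2)) ∧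
      genRank ({((0 : Fin 2), (0 : Fin 2))} ∪ {((0 : Fin 2), (1 : Fin 2))}) -
          genRank {((0 : Fin 2), (0 : Fin 2))} = 0 ∧
      genRank (({((0 : Fin 2), (0 : Fin 2)), ((1 : Fin 2), (0 : Fin 2))} : Set (Fin 2 × Fin 2))
            ∪ {((0 : Fin 2), (1 : Fin 2))}) -
          genRank ({((0 : Fin 2), (0 : Fin 2)), ((1 : Fin 2), (0 : Fin 2))} :
            Set (Fin 2 × Fin 2)) = 1 ∧
      genRank ({((0 : Fin 2), (0 : Fin 2))} ∪ {((0 : Fin 2), (1 : Fin 2))}) -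
          genRank {((0 : Fin 2), (0 : Fin 2))} <
        genRank (({((0 : Fin 2), (0 : Fin 2)), ((1 : Fin 2), (0 : Fin 2))} :
              Set (Fin 2 × Fin 2)) ∪ {((0 : Fin 2), (1 : Fin 2))}) -
          genRank ({((0 : Fin 2), (0 : Fin 2)), ((1 : Fin 2), (0 : Fin 2))} :
            Set (Fin 2 × Fin 2)) := by
  have h1 : genRank {((0 : Fin 2), (0 : Fin 2))} = 1 :=
    genRank_eq_one (by simp) fun M hM => by
      simp [Matrix.det_fin_two, hM 1 1 (by simp), hM 1 0 (by simp)]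
  have h1e : genRank ({((0 : Fin 2), (0 : Fin 2))} ∪ {((0 : Fin 2), (1 : Fin 2))}) = 1 :=
    genRank_eq_one (by simp) fun M hM => by
      simp [Matrix.det_fin_two, hM 1 1 (by simp), hM 1 0 (by simp)]
  have h2 : genRank ({((0 : Fin 2), (0 : Fin 2)), ((1 : Fin 2), (0 : Fin 2))} :
      Set (Fin 2 × Fin 2)) = 1 :=
    genRank_eq_one (by simp) fun M hM => by
      simp [Matrix.det_fin_two, hM 1 1 (by simp), hM 0 1 (by simp)]
  have h2e : genRank (({((0 : Fin 2), (0 : Fin 2)), ((1 : Fin 2), (0 : Fin 2))} :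
      Set (Fin 2 × Fin 2)) ∪ {((0 : Fin 2), (1 : Fin 2))}) = 2 :=
    genRank_eq_two (by simp) (by simp)
  rw [h1, h1e, h2, h2e]
  exact ⟨by simp, by norm_num, by norm_num, by norm_num⟩
end
end
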